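/- arXiv:2010.12336 — 2 statements merged into one kernel-verified Lean document; each statement's English description precedes it below -/
import Mathlib

section
/- There is a homeomorphism Φ from the configuration space C₂(S²) = {(x,y) ∈ S² × S² : x ≠ y} onto the total space of the tangent bundle of S², realized as TS² = {(x,v) ∈ S² × ℝ³ : ⟨x,v⟩ = 0} (with the subspace topology from S² × ℝ³), and Φ restricts to a homeomorphism from the antipodal orbit configuration space C₂^±(S²) = {(x,y) ∈ S² × S² : y ≠ x and y ≠ −x} onto the complement of the zero section, {(x,v) ∈ S² × ℝ³ : ⟨x,v⟩ = 0 and v ≠ 0}. -/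
/-- The unit 2-sphere in euclidean 3-space. -/
abbrev TwoSphere : Set (EuclideanSpace ℝ (Fin 3)) :=
  Metric.sphere (0 : EuclideanSpace ℝ (Fin 3)) 1

/-- The configuration space `C₂(S²)` of two ordered distinct points of `S²`. -/
abbrev ConfTwoSphere : Type :=
  {p : ↥TwoSphere × ↥TwoSphere // p.1 ≠ p.2}

/-- The total space of the tangent bundle of `S²`, realized as the pairs
`(x, v) ∈ S² × ℝ³` with `⟨x, v⟩ = 0`. -/
abbrev TangentSphere : Type :=
  {v : ↥TwoSphere × EuclideanSpace ℝ (Fin 3) //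
    (inner ℝ (v.1 : EuclideanSpace ℝ (Fin 3)) v.2 : ℝ) = 0}

section Stereographic

open Metric
open scoped RealInnerProductSpace

variable {E : Type*} [NormedAddCommGroup E] [InnerProductSpace ℝ E]

/-- Stereographic projection of `y` from the pole `x` onto the hyperplane orthogonal to `x`. -/
noncomputable def stereoProj (x y : E) : E := (1 - ⟪x, y⟫)⁻¹ • (y - ⟪x, y⟫ • x)

/-- The point of the unit sphere whose stereographic projection from the pole `x` is `v`. -/
noncomputable def stereoLift (x v : E) : E :=
  (‖v‖ ^ 2 + 1)⁻¹ • ((2 : ℝ) • v + (‖v‖ ^ 2 - 1) • x)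

lemma inner_stereoProj {x : E} (hx : ‖x‖ = 1) (y : E) : ⟪x, stereoProj x y⟫ = 0 := by
  simp [stereoProj, inner_smul_right, inner_sub_right, hx]

lemma norm_stereoProj_sq {x y : E} (hx : ‖x‖ = 1) (hy : ‖y‖ = 1) (h : ⟪x, y⟫ ≠ 1) :
    ‖stereoProj x y‖ ^ 2 = (1 + ⟪x, y⟫) / (1 - ⟪x, y⟫) := by
  have h' : 1 - ⟪x, y⟫ ≠ 0 := sub_ne_zero.2 h.symm
  rw [stereoProj, norm_smul, mul_pow, norm_sub_sq_real, norm_smul, inner_smul_right,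
    real_inner_comm, hx, hy, Real.norm_eq_abs, Real.norm_eq_abs, sq_abs, mul_one, sq_abs]
  rw [real_inner_comm] at h' ⊢
  field_simp
  ring

lemma inner_stereoLift {x v : E} (hx : ‖x‖ = 1) (hv : ⟪x, v⟫ = 0) :
    ⟪x, stereoLift x v⟫ = (‖v‖ ^ 2 - 1) / (‖v‖ ^ 2 + 1) := by
  simp only [stereoLift, inner_smul_right, inner_add_right, hv, real_inner_self_eq_norm_sq, hx]
  ring

lemma inner_stereoLift_ne_one {x v : E} (hx : ‖x‖ = 1) (hv : ⟪x, v⟫ = 0) :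
    ⟪x, stereoLift x v⟫ ≠ 1 := by
  rw [inner_stereoLift hx hv, Ne, div_eq_one_iff_eq (by positivity)]
  linarith

lemma norm_stereoLift {x v : E} (hx : ‖x‖ = 1) (hv : ⟪x, v⟫ = 0) : ‖stereoLift x v‖ = 1 := by
  rw [← sq_eq_sq₀ (norm_nonneg _) zero_le_one, stereoLift, norm_smul, mul_pow, norm_add_sq_real,
    norm_smul, norm_smul, inner_smul_left, inner_smul_right, real_inner_comm, hv, hx]
  simp only [Real.norm_eq_abs, mul_pow, sq_abs]
  have : ‖v‖ ^ 2 + 1 ≠ 0 := by positivity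
  field_simp
  ring

lemma stereoLift_stereoProj {x y : E} (hx : ‖x‖ = 1) (hy : ‖y‖ = 1) (h : ⟪x, y⟫ ≠ 1) :
    stereoLift x (stereoProj x y) = y := by
  have h' : 1 - ⟪x, y⟫ ≠ 0 := sub_ne_zero.2 h.symm
  have hadd : ‖stereoProj x y‖ ^ 2 + 1 = 2 / (1 - ⟪x, y⟫) := by
    rw [norm_stereoProj_sq hx hy h]
    field_simp
    ring
  have hsub : ‖stereoProj x y‖ ^ 2 - 1 = 2 * ⟪x, y⟫ / (1 - ⟪x, y⟫) := by
    rw [norm_stereoProj_sq hx hy h]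
    field_simp
    ring
  rw [stereoLift, hadd, hsub, stereoProj]
  match_scalars <;> field_simp
  ring

lemma stereoProj_stereoLift {x v : E} (hx : ‖x‖ = 1) (hv : ⟪x, v⟫ = 0) :
    stereoProj x (stereoLift x v) = v := by
  have h : ‖v‖ ^ 2 + 1 ≠ 0 := by positivity
  have hsub : 1 - (‖v‖ ^ 2 - 1) / (‖v‖ ^ 2 + 1) = 2 / (‖v‖ ^ 2 + 1) := by
    field_simp
    ring
  rw [stereoProj, inner_stereoLift hx hv, hsub, stereoLift]
  match_scalars <;> field_simp
  ring

lemma stereoProj_eq_zero_iff {x y : E} (hx : ‖x‖ = 1) (hy : ‖y‖ = 1) (h : ⟪x, y⟫ ≠ 1) :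
    stereoProj x y = 0 ↔ y = -x := by
  constructor
  · intro h0
    rw [← stereoLift_stereoProj hx hy h, h0]
    simp [stereoLift]
  · rintro rfl
    simp [stereoProj, hx]

/-- Stereographic projection from a varying pole, as a homeomorphism from the ordered pairs of
distinct points of the unit sphere to the total space of its tangent bundle. -/
noncomputable def stereoHomeomorph :
    {p : sphere (0 : E) 1 × sphere (0 : E) 1 // p.1 ≠ p.2} ≃ₜ
      {v : sphere (0 : E) 1 × E // ⟪(v.1 : E), v.2⟫ = 0} where
  toFun q := ⟨(q.1.1, stereoProj (q.1.1 : E) q.1.2), inner_stereoProj (norm_eq_of_mem_sphere _) _⟩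
  invFun v := ⟨(v.1.1, ⟨stereoLift (v.1.1 : E) v.1.2, mem_sphere_zero_iff_norm.2
      (norm_stereoLift (norm_eq_of_mem_sphere _) v.2)⟩), fun h ↦
    inner_stereoLift_ne_one (norm_eq_of_mem_sphere _) v.2 ((sphere_ext_iff _ _).1 h)⟩
  left_inv q := Subtype.ext <| Prod.ext rfl <| Subtype.ext <|
    stereoLift_stereoProj (norm_eq_of_mem_sphere _) (norm_eq_of_mem_sphere _)
      fun h ↦ q.2 ((sphere_ext_iff _ _).2 h)
  right_inv v := Subtype.ext <| Prod.ext rfl <|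
    stereoProj_stereoLift (norm_eq_of_mem_sphere _) v.2
  continuous_toFun := by
    have h (q : {p : sphere (0 : E) 1 × sphere (0 : E) 1 // p.1 ≠ p.2}) :
        1 - ⟪(q.1.1 : E), q.1.2⟫ ≠ 0 :=
      sub_ne_zero.2 fun h ↦ q.2 ((sphere_ext_iff _ _).2 h.symm)
    unfold stereoProj
    fun_prop (disch := assumption)
  continuous_invFun := by
    have h (v : {v : sphere (0 : E) 1 × E // ⟪(v.1 : E), v.2⟫ = 0}) : ‖v.1.2‖ ^ 2 + 1 ≠ 0 := by
      positivity
    unfold stereoLift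
    fun_prop (disch := assumption)

end Stereographic

/-- There is a homeomorphism `Φ : C₂(S²) ≃ₜ TS²` which carries the antipodal
orbit configuration space `{(x,y) : y ≠ x, y ≠ -x}` exactly onto the complement
of the zero section (hence restricts to a homeomorphism between them). -/
theorem stmt_9 :
    ∃ Φ : ConfTwoSphere ≃ₜ TangentSphere,
      ∀ q : ConfTwoSphere, (Φ q).val.2 ≠ 0 ↔ q.val.2 ≠ -q.val.1 := by
  exact ⟨stereoHomeomorph, fun q ↦ not_congr <|
    (stereoProj_eq_zero_iff (norm_eq_of_mem_sphere _) (norm_eq_of_mem_sphere _)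
      fun h ↦ q.2 ((sphere_ext_iff _ _).2 h)).trans
        (Subtype.ext_iff (a1 := q.1.2) (a2 := -q.1.1)).symm⟩
end

section
/- Let X = ℂ ∖ {0,1} and n ≥ 1. The map s : C_n(X) → C_{n+1}(X) defined by s(z₁,…,zₙ) = (z₁,…,zₙ, 1 + |z₁| + ⋯ + |zₙ|) is well defined (its last coordinate lies in X and differs from every zᵢ) and continuous, and it is a cross-section of the projection π^n : C_{n+1}(X) → C_n(X) onto the first n coordinates, i.e. π^n ∘ s = id. In particular π^n admits a cross-section. -/
/-- The twice-punctured plane `ℂ ∖ {0, 1}`. -/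
abbrev TwicePunctPlane : Type := {z : ℂ // z ≠ 0 ∧ z ≠ 1}

/-- The ordered configuration space of `n` points of `ℂ ∖ {0, 1}`. -/
abbrev ConfX (n : ℕ) : Type :=
  {f : Fin n → TwicePunctPlane // ∀ i j : Fin n, i ≠ j → f i ≠ f j}

/-- The projection `π^n : C_{n+1}(ℂ ∖ {0,1}) → C_n(ℂ ∖ {0,1})` onto the first
`n` coordinates. -/
def projX (n : ℕ) (q : ConfX (n + 1)) : ConfX n :=
  ⟨fun i => q.val i.castSucc, fun i j hij =>
    q.2 i.castSucc j.castSucc fun h => hij (Fin.castSucc_injective n h)⟩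

/-- The radius `1 + |z₁| + ⋯ + |zₙ|` strictly exceeds the modulus of every `zᵢ`. -/
theorem norm_lt_one_add_sum_norm {ι E : Type*} [Fintype ι] [SeminormedAddCommGroup E]
    (z : ι → E) (i : ι) : ‖z i‖ < 1 + ∑ j, ‖z j‖ := by
  have h := Finset.single_le_sum (f := fun j => ‖z j‖) (fun j _ => norm_nonneg _)
    (Finset.mem_univ i)
  linarith

/-- The point `1 + |z₁| + ⋯ + |zₙ|` of `ℂ ∖ {0, 1}`, for `n ≥ 1`. -/
noncomputable def farPoint {n : ℕ} (hn : 1 ≤ n) (z : Fin n → TwicePunctPlane) :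
    TwicePunctPlane :=
  ⟨((1 + ∑ i, ‖(z i : ℂ)‖ : ℝ) : ℂ), by
    have hpos : 0 < ∑ i, ‖(z i : ℂ)‖ :=
      Finset.sum_pos (fun i _ => norm_pos_iff.mpr (z i).2.1) ⟨⟨0, hn⟩, Finset.mem_univ _⟩
    constructor
    · exact Complex.ofReal_ne_zero.mpr (by positivity)
    · exact Complex.ofReal_ne_one.mpr (by linarith)⟩

theorem continuous_farPoint {n : ℕ} (hn : 1 ≤ n) : Continuous (farPoint hn) := by
  unfold farPoint
  fun_prop

theorem ne_farPoint {n : ℕ} (hn : 1 ≤ n) (z : Fin n → TwicePunctPlane) (i : Fin n) :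
    z i ≠ farPoint hn z := by
  intro h
  have hlt := norm_lt_one_add_sum_norm (fun j => (z j : ℂ)) i
  have hnorm : ‖(z i : ℂ)‖ = 1 + ∑ j, ‖(z j : ℂ)‖ := by
    rw [h]
    exact Complex.norm_of_nonneg (by positivity)
  exact hlt.ne hnorm

/-- The map `(z₁,…,zₙ) ↦ (z₁,…,zₙ, 1 + |z₁| + ⋯ + |zₙ|)` on configuration spaces. -/
noncomputable def appendFarPoint {n : ℕ} (hn : 1 ≤ n) (p : ConfX n) : ConfX (n + 1) :=
  ⟨Fin.snoc (α := fun _ => TwicePunctPlane) p.val (farPoint hn p.val), by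
    intro i j hij
    induction i using Fin.lastCases with
    | last =>
      induction j using Fin.lastCases with
      | last => exact absurd rfl hij
      | cast j => simpa using (ne_farPoint hn p.val j).symm
    | cast i =>
      induction j using Fin.lastCases with
      | last => simpa using ne_farPoint hn p.val i
      | cast j =>
        rw [Fin.snoc_castSucc, Fin.snoc_castSucc]
        exact p.2 i j fun h => hij (congrArg Fin.castSucc h)⟩

theorem continuous_appendFarPoint {n : ℕ} (hn : 1 ≤ n) :
    Continuous (appendFarPoint hn) := by
  refine Continuous.subtype_mk ?_ _
  exact Continuous.finSnoc (A := fun _ => TwicePunctPlane) continuous_subtype_val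
    ((continuous_farPoint hn).comp continuous_subtype_val)

/-- The map `s(z₁,…,zₙ) = (z₁,…,zₙ, 1 + |z₁| + ⋯ + |zₙ|)` is a well-defined
continuous cross-section of the projection
`π^n : C_{n+1}(ℂ ∖ {0,1}) → C_n(ℂ ∖ {0,1})`; in particular `π^n` admits a
cross-section. -/
theorem stmt_14 (n : ℕ) (hn : 1 ≤ n) :
    ∃ s : ConfX n → ConfX (n + 1),
      Continuous s ∧
      (∀ p : ConfX n, ∀ i : Fin n, (s p).val i.castSucc = p.val i) ∧
      (∀ p : ConfX n, ((s p).val (Fin.last n) : ℂ) =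
        1 + ∑ i : Fin n, ‖(p.val i : ℂ)‖) ∧
      (∀ p : ConfX n, projX n (s p) = p) := by
  have hcast (p : ConfX n) (i : Fin n) : (appendFarPoint hn p).val i.castSucc = p.val i :=
    Fin.snoc_castSucc (α := fun _ => TwicePunctPlane) _ _ _
  refine ⟨appendFarPoint hn, continuous_appendFarPoint hn, hcast, fun p => ?_,
    fun p => Subtype.ext (funext (hcast p))⟩
  simp [appendFarPoint, farPoint]
end
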